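/- Assume A satisfies condition (103) with lim_{p→∞} pA(p) < ∞, and f satisfies condition (109). Then the generalized Hessian inequality (101), σ_k(λ(D_i(A(|Du|)D_j u)))^{1/k} ≥ f(u) at every point of ℝ^n, has no positive solution u ∈ C²(ℝ^n∖{0}) ∩ Φ^k(ℝ^n). -/

import Mathlib

open Filter MeasureTheory Set Topology
open scoped ENNReal

noncomputable section

abbrev Euc (n : ℕ) := EuclideanSpace ℝ (Fin n)

/-- k-th elementary symmetric function of λ ∈ ℝⁿ. -/
def sigmaElem (n k : ℕ) (lam : Fin n → ℝ) : ℝ :=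
  ∑ S ∈ Finset.powersetCard k (Finset.univ : Finset (Fin n)), ∏ i ∈ S, lam i

/-- The cone Γ_k. -/
def GammaK (n k : ℕ) : Set (Fin n → ℝ) :=
  {lam | ∀ l, 1 ≤ l → l ≤ k → 0 < sigmaElem n l lam}

/-- Matrix (D_i V_j) of a vector field V. -/
def jacMatrix {n : ℕ} (V : Euc n → Euc n) (x : Euc n) : Matrix (Fin n) (Fin n) ℝ :=
  fun i j => fderiv ℝ (fun y => V y j) x (EuclideanSpace.single i 1)

/-- Condition (103). -/
def Cond103 (A : ℝ → ℝ) : Prop :=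
  ContDiffOn ℝ 1 A (Ioi 0) ∧ (∀ p ∈ Ioi (0:ℝ), 0 < A p) ∧
  ContinuousOn (fun p => p * A p) (Ici 0) ∧
  StrictMonoOn (fun p => p * A p) (Ioi 0)

/-- Condition (109). -/
def Cond109 (f : ℝ → ℝ) : Prop :=
  ContinuousOn f (Ioi 0) ∧ (∀ t ∈ Ioi (0:ℝ), 0 < f t) ∧ MonotoneOn f (Ioi 0)

/-- Condition (117). -/
def Cond117 (f : ℝ → ℝ) : Prop :=
  Continuous f ∧ (∀ t, 0 < f t) ∧ Monotone f

/-- Condition (108): 0 < liminf A(p)/p^{m-2} ≤ limsup A(p)/p^{m-2} < ∞. -/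
def Cond108 (A : ℝ → ℝ) (m : ℝ) : Prop :=
  ∃ c₁ c₂ : ℝ, 0 < c₁ ∧
    ∀ᶠ p in atTop, c₁ ≤ A p / p ^ (m - 2) ∧ A p / p ^ (m - 2) ≤ c₂

/-- u ∈ C²(ℝⁿ \ {0}) ∩ Φᵏ(ℝⁿ) is an entire solution of inequality (101). -/
def IsEntireSol (n k : ℕ) (A f : ℝ → ℝ) (u : Euc n → ℝ) : Prop :=
  ContDiff ℝ 1 u ∧ ContDiffOn ℝ 2 u {(0 : Euc n)}ᶜ ∧
  ∃ V : Euc n → Euc n, ContDiff ℝ 1 V ∧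
    (∀ x, V x = A ‖gradient u x‖ • gradient u x) ∧
    ∃ hsym : ∀ x, (jacMatrix V x).IsHermitian,
      (∀ x, (hsym x).eigenvalues ∈ GammaK n k) ∧
      ∀ x, f (u x) ≤ (sigmaElem n k ((hsym x).eigenvalues)) ^ ((1:ℝ)/k)

/-- Ψ(p) = p (pA(p))^k − ∫₀^p (tA(t))^k dt. -/
def Psi (A : ℝ → ℝ) (k : ℕ) (p : ℝ) : ℝ :=
  p * (p * A p) ^ k - ∫ t in (0:ℝ)..p, (t * A t) ^ k

/-- Ψ⁻¹, the inverse of Ψ on [0,∞). -/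
def PsiInv (A : ℝ → ℝ) (k : ℕ) : ℝ → ℝ :=
  Function.invFunOn (Psi A k) (Ici 0)

/-- Generalized Keller–Osserman condition (110) with lower limit c. -/
def KO (A f : ℝ → ℝ) (k : ℕ) (c : ℝ) : Prop :=
  ∫⁻ s in Ioi c, ENNReal.ofReal (PsiInv A k (∫ t in c..s, f t ^ k))⁻¹ = ⊤

/-- [0,R) with R ∈ [0,∞]. -/
def IcoE (R : ℝ≥0∞) : Set ℝ := {r : ℝ | 0 ≤ r ∧ ENNReal.ofReal r < R}

/-- (0,R) with R ∈ [0,∞]. -/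
def IooE (R : ℝ≥0∞) : Set ℝ := {r : ℝ | 0 < r ∧ ENNReal.ofReal r < R}

/-- φ is a positive solution of the Cauchy problem (204) on [0,R). -/
def IsCauchySol (n k : ℕ) (A f : ℝ → ℝ) (a : ℝ) (R : ℝ≥0∞) (φ : ℝ → ℝ) : Prop :=
  ContinuousOn φ (IcoE R) ∧
  (∀ r ∈ IooE R, DifferentiableAt ℝ φ r) ∧
  ContinuousOn (deriv φ) (IooE R) ∧
  φ 0 = a ∧
  (∀ r ∈ IcoE R, 0 < φ r) ∧
  ∀ r ∈ IooE R,
    A |deriv φ r| * deriv φ r =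
      (n * r ^ ((k:ℝ) - n) / (n.choose k) * ∫ s in (0:ℝ)..r, s ^ (n-1) * f (φ s) ^ k) ^ ((1:ℝ)/k)


lemma sigmaElem_one (n : ℕ) (lam : Fin n → ℝ) : sigmaElem n 1 lam = ∑ i, lam i := by
  simp [sigmaElem, Finset.powersetCard_one]

lemma sum_sq_eq_sigmaElem (n : ℕ) (lam : Fin n → ℝ) :
    ∑ i, lam i ^ 2 = sigmaElem n 1 lam ^ 2 - 2 * sigmaElem n 2 lam := by
  have newton := congrArg (MvPolynomial.aeval lam) (MvPolynomial.mul_esymm_eq_sum (Fin n) ℝ 2)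
  have indices : (Finset.HasAntidiagonal.antidiagonal 2).filter (fun a : ℕ × ℕ => a.1 < 2) =
      {(0, 2), (1, 1)} := by
    decide
  rw [indices] at newton
  simp [MvPolynomial.esymm, MvPolynomial.psum, Finset.powersetCard_one] at newton
  rw [sigmaElem_one]
  simp only [sigmaElem]
  linarith

/-- On the cone `Γ_k`, `σ_k` is controlled by a power of `σ_1`. -/
lemma sigmaElem_le_of_mem_GammaK {n k : ℕ} (hk : 1 ≤ k) {lam : Fin n → ℝ}
    (hlam : lam ∈ GammaK n k) :
    sigmaElem n k lam ≤ n.choose k * sigmaElem n 1 lam ^ k := by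
  have sigma_one_pos : 0 < sigmaElem n 1 lam := hlam 1 le_rfl hk
  rcases hk.eq_or_lt with rfl | hk
  · have n_pos : 1 ≤ n := by
      rcases Nat.eq_zero_or_pos n with rfl | h
      · simp [sigmaElem_one] at sigma_one_pos
      · exact h
    have : (1 : ℝ) ≤ n := by exact_mod_cast n_pos
    simp only [Nat.choose_one_right, pow_one]
    nlinarith
  have abs_le (i : Fin n) : |lam i| ≤ sigmaElem n 1 lam := by
    refine abs_le_of_sq_le_sq ?_ sigma_one_pos.le
    have := Finset.single_le_sum (f := fun i => lam i ^ 2) (fun _ _ => sq_nonneg _)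
      (Finset.mem_univ i)
    have := sum_sq_eq_sigmaElem n lam
    have := hlam 2 (by norm_num) hk
    linarith
  calc sigmaElem n k lam
      ≤ ∑ S ∈ Finset.powersetCard k (Finset.univ : Finset (Fin n)), sigmaElem n 1 lam ^ k := by
        refine Finset.sum_le_sum fun S hS => (le_abs_self _).trans ?_
        rw [Finset.abs_prod, ← (Finset.mem_powersetCard.1 hS).2, ← Finset.prod_const]
        exact Finset.prod_le_prod (fun _ _ => abs_nonneg _) fun i _ => abs_le i
    _ = n.choose k * sigmaElem n 1 lam ^ k := by simp

lemma le_trace_of_le_sigmaElem_rpow {n k : ℕ} (hk : 1 ≤ k) {M : Matrix (Fin n) (Fin n) ℝ}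
    (hM : M.IsHermitian) (hcone : hM.eigenvalues ∈ GammaK n k) {s : ℝ}
    (hs : s ≤ sigmaElem n k hM.eigenvalues ^ ((1 : ℝ) / k)) :
    s ≤ (n.choose k : ℝ) ^ ((1 : ℝ) / k) * M.trace := by
  have trace_eq : M.trace = sigmaElem n 1 hM.eigenvalues := by
    rw [sigmaElem_one, hM.trace_eq_sum_eigenvalues]
    simp
  have sigma_one_pos := hcone 1 le_rfl hk
  rw [trace_eq]
  refine hs.trans ((Real.rpow_le_rpow (hcone k hk le_rfl).le (sigmaElem_le_of_mem_GammaK hk hcone)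
    (by positivity)).trans_eq ?_)
  rw [Real.mul_rpow (by positivity) (by positivity), one_div,
    Real.pow_rpow_inv_natCast sigma_one_pos.le (by omega)]

lemma Cond103.strictMonoOn_Ici {A : ℝ → ℝ} (hA : Cond103 A) :
    StrictMonoOn (fun p => p * A p) (Ici 0) := by
  intro p hp q hq hpq
  rcases (show (0 : ℝ) ≤ p from hp).eq_or_lt with rfl | hp
  · simpa using mul_pos hpq (hA.2.1 q hpq)
  · exact hA.2.2.2 hp (hp.trans hpq) hpq

lemma Cond103.mul_le_of_tendsto {A : ℝ → ℝ} (hA : Cond103 A) {L : ℝ}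
    (hL : Tendsto (fun p => p * A p) atTop (𝓝 L)) {p : ℝ} (hp : 0 ≤ p) : p * A p ≤ L :=
  ge_of_tendsto hL <| (eventually_ge_atTop p).mono fun q hq =>
    hA.strictMonoOn_Ici.monotoneOn hp (hp.trans hq : (0 : ℝ) ≤ q) hq

/-- A continuous increasing inverse of `p ↦ p A(p)` on `[0, P A(P)]`, extended to `ℝ`. -/
lemma Cond103.exists_inverse {A : ℝ → ℝ} (hA : Cond103 A) {P : ℝ} (hP : 0 < P) :
    ∃ G : ℝ → ℝ, Continuous G ∧ StrictMono G ∧ G 0 = 0 ∧ G (P * A P) = P ∧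
      ∀ s ∈ Icc 0 (P * A P), G s * A (G s) = s := by
  set q : ℝ → ℝ := fun p => max 0 (min P p) with hq
  have q_nonneg (p : ℝ) : 0 ≤ q p := le_max_left _ _
  have q_of_mem {p : ℝ} (hp : p ∈ Icc 0 P) : q p = p := by simp [hq, hp.1, hp.2]
  set H : ℝ → ℝ := fun p => q p * A (q p) + (p - q p) with hH
  have H_of_mem {p : ℝ} (hp : p ∈ Icc 0 P) : H p = p * A p := by simp [hH, q_of_mem hp]
  have H_cont : Continuous H := by
    have q_cont : Continuous q := by fun_prop
    exact (hA.2.2.1.comp_continuous q_cont q_nonneg).add (continuous_id.sub q_cont)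
  have H_mono : StrictMono H := by
    intro a b hab
    have q_le : q a ≤ q b := max_le_max le_rfl (min_le_min le_rfl hab.le)
    have sub_le : q b - q a ≤ b - a := by
      simp only [hq, max_def, min_def]
      split_ifs <;> linarith
    rcases q_le.eq_or_lt with h | h
    · simp only [hH, h]
      linarith
    · have := hA.strictMonoOn_Ici (q_nonneg a) (q_nonneg b) h
      simp only [hH] at *
      linarith
  have g_nonneg (p : ℝ) (hp : 0 ≤ p) : 0 ≤ p * A p := by
    simpa using hA.strictMonoOn_Ici.monotoneOn self_mem_Ici hp hp
  have H_surj : Function.Surjective H := by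
    refine H_cont.surjective ?_ ?_
    · refine tendsto_atTop_mono (f := fun p => p - P) (fun p => ?_)
        (tendsto_atTop_add_const_right _ _ tendsto_id)
      have := g_nonneg (q p) (q_nonneg p)
      have : q p ≤ P := max_le hP.le (min_le_left _ _)
      simp only [hH]
      linarith
    · refine tendsto_atBot_mono' _ ?_ tendsto_id
      filter_upwards [eventually_le_atBot 0] with p hp
      have : q p = 0 := max_eq_left ((min_le_right _ _).trans hp)
      simp [hH, this]
  set e := H_mono.orderIsoOfSurjective H H_surj
  have symm_H (p : ℝ) : e.symm (H p) = p := e.symm_apply_apply p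
  have symm_zero : e.symm 0 = 0 := by
    simpa [H_of_mem (left_mem_Icc.2 hP.le)] using symm_H 0
  have symm_P : e.symm (P * A P) = P := by
    simpa [H_of_mem (right_mem_Icc.2 hP.le)] using symm_H P
  refine ⟨e.symm, e.symm.continuous, e.symm.strictMono, symm_zero, symm_P, fun s hs => ?_⟩
  rw [← H_of_mem]
  · exact e.apply_symm_apply s
  · exact ⟨symm_zero ▸ e.symm.monotone hs.1, symm_P ▸ e.symm.monotone hs.2⟩

/-- The vector field `a ↦ A(|a|) a` is monotone. -/
lemma Cond103.inner_smul_sub_smul_nonneg {A : ℝ → ℝ} (hA : Cond103 A) {E : Type*}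
    [NormedAddCommGroup E] [InnerProductSpace ℝ E] (a b : E) :
    0 ≤ inner ℝ (A ‖a‖ • a - A ‖b‖ • b) (a - b) := by
  have cross_le (c d : E) : A ‖c‖ * inner ℝ c d ≤ A ‖c‖ * (‖c‖ * ‖d‖) := by
    rcases eq_or_ne c 0 with rfl | hc
    · simp
    · exact mul_le_mul_of_nonneg_left (real_inner_le_norm c d)
        (hA.2.1 _ (norm_pos_iff.2 hc)).le
  have mono : 0 ≤ (‖a‖ * A ‖a‖ - ‖b‖ * A ‖b‖) * (‖a‖ - ‖b‖) := by
    have g_mono := hA.strictMonoOn_Ici.monotoneOn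
    rcases le_total ‖a‖ ‖b‖ with h | h
    · exact mul_nonneg_of_nonpos_of_nonpos
        (sub_nonpos.2 (g_mono (norm_nonneg a) (norm_nonneg b) h)) (sub_nonpos.2 h)
    · exact mul_nonneg (sub_nonneg.2 (g_mono (norm_nonneg b) (norm_nonneg a) h)) (sub_nonneg.2 h)
  have hab := cross_le a b
  have hba := cross_le b a
  simp only [inner_sub_left, inner_sub_right, real_inner_smul_left, real_inner_self_eq_norm_sq]
  linarith

section Radial

variable {E : Type*} [NormedAddCommGroup E] [InnerProductSpace ℝ E]

lemma hasFDerivAt_norm_of_ne_zero {x : E} (hx : x ≠ 0) :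
    HasFDerivAt (fun y : E => ‖y‖) (‖x‖⁻¹ • innerSL ℝ x) x := by
  have norm_pos : 0 < ‖x‖ := norm_pos_iff.2 hx
  have := (hasStrictFDerivAt_norm_sq x).hasFDerivAt.sqrt (by positivity)
  simp only [Real.sqrt_sq (norm_nonneg _)] at this
  convert this using 1
  ext y
  simp
  field_simp

/-- A radial function whose profile has derivative `D` with `D 0 = 0` is differentiable. -/
lemma hasFDerivAt_radial {ω D : ℝ → ℝ} (hω : ∀ r, HasDerivAt ω (D r) r) (hD : D 0 = 0) (x : E) :
    HasFDerivAt (fun y : E => ω ‖y‖) (innerSL ℝ ((D ‖x‖ / ‖x‖) • x)) x := by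
  rcases eq_or_ne x 0 with rfl | hx
  · have at_zero := hω 0
    rw [hD, hasDerivAt_iff_isLittleO_nhds_zero] at at_zero
    have := at_zero.comp_tendsto (tendsto_norm_zero (E := E))
    rw [hasFDerivAt_iff_isLittleO_nhds_zero]
    refine (Asymptotics.isLittleO_norm_right.1 (this.congr (fun y => ?_) fun y => rfl))
    simp
  · have := (hω ‖x‖).comp_hasFDerivAt x (hasFDerivAt_norm_of_ne_zero hx)
    rwa [smul_smul, ← div_eq_mul_inv, ← map_smul] at this

lemma continuous_radial_field {D : ℝ → ℝ} (hcont : Continuous D) (hD : D 0 = 0) :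
    Continuous fun x : E => (D ‖x‖ / ‖x‖) • x := by
  refine continuous_iff_continuousAt.2 fun x => ?_
  rcases eq_or_ne x 0 with rfl | hx
  · have bound (y : E) : ‖(D ‖y‖ / ‖y‖) • y‖ ≤ |D ‖y‖| := by
      rcases eq_or_ne y 0 with rfl | hy
      · simp
      · rw [norm_smul, norm_div, norm_norm, div_mul_cancel₀ _ (norm_ne_zero_iff.2 hy),
          Real.norm_eq_abs]
    have limit : Tendsto (fun y : E => |D ‖y‖|) (𝓝 0) (𝓝 0) := by
      have : Continuous fun y : E => |D ‖y‖| := by fun_prop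
      simpa [hD] using this.tendsto 0
    simpa [ContinuousAt] using squeeze_zero_norm bound limit
  · have := norm_ne_zero_iff.2 hx
    fun_prop (disch := assumption)

end Radial

/-- The divergence of a compactly supported `C¹` vector field has integral zero. -/
lemma integral_divergence_eq_zero {n : ℕ} {Y : Euc n → Euc n} (hY : ContDiff ℝ 1 Y)
    (hsupp : HasCompactSupport Y) : ∫ x, (jacMatrix Y x).trace = 0 := by
  have comp_contDiff (i : Fin n) : ContDiff ℝ 1 fun x => Y x i := by fun_prop
  have comp_supp (i : Fin n) : HasCompactSupport fun x => Y x i :=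
    hsupp.comp_left (g := fun y : Euc n => y i) rfl
  have deriv_integrable (i : Fin n) : Integrable fun x =>
      fderiv ℝ (fun y => Y y i) x (EuclideanSpace.single i 1) := by
    refine Continuous.integrable_of_hasCompactSupport ?_ ?_
    · exact ((comp_contDiff i).continuous_fderiv one_ne_zero).clm_apply continuous_const
    · exact (comp_supp i).fderiv_apply ℝ _
  simp only [Matrix.trace, Matrix.diag, jacMatrix]
  rw [integral_finsetSum _ fun i _ => deriv_integrable i]
  refine Finset.sum_eq_zero fun i _ => ?_
  have := integral_mul_fderiv_eq_neg_fderiv_mul_of_integrable (𝕜 := ℝ) (μ := volume)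
    (f := fun _ : Euc n => (1 : ℝ)) (g := fun x => Y x i) (v := EuclideanSpace.single i 1)
    (by simp) (by simpa using deriv_integrable i)
    (by simpa using (comp_contDiff i).continuous.integrable_of_hasCompactSupport (comp_supp i))
    (fun _ _ => differentiableAt_const _)
    (fun x _ => (comp_contDiff i).differentiable one_ne_zero x)
  simpa using this

lemma trace_jacMatrix_smul {n : ℕ} {h : Euc n → ℝ} {Z : Euc n → Euc n} {x : Euc n}
    (hh : DifferentiableAt ℝ h x) (hZ : DifferentiableAt ℝ Z x) :
    (jacMatrix (fun y => h y • Z y) x).trace =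
      h x * (jacMatrix Z x).trace + fderiv ℝ h x (Z x) := by
  have expand : fderiv ℝ h x (Z x) =
      ∑ i, Z x i * fderiv ℝ h x (EuclideanSpace.single i 1) := by
    conv_lhs => rw [← (EuclideanSpace.basisFun (Fin n) ℝ).sum_repr (Z x)]
    simp
  have product_rule (i : Fin n) : fderiv ℝ (fun y => h y * Z y i) x =
      h x • fderiv ℝ (fun y => Z y i) x + Z x i • fderiv ℝ h x :=
    fderiv_fun_mul hh (by fun_prop)
  simp [Matrix.trace, jacMatrix, product_rule, expand, Finset.sum_add_distrib, Finset.mul_sum]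

lemma trace_jacMatrix_sub_smul_id {n : ℕ} {V : Euc n → Euc n} {x : Euc n}
    (hV : DifferentiableAt ℝ V x) (κ : ℝ) :
    (jacMatrix (fun y => V y - κ • y) x).trace = (jacMatrix V x).trace - n * κ := by
  have entry (i : Fin n) : fderiv ℝ (fun y => V y i - κ * y i) x (EuclideanSpace.single i 1) =
      fderiv ℝ (fun y => V y i) x (EuclideanSpace.single i 1) - κ := by
    have hproj : HasFDerivAt (fun y : Euc n => y i) (EuclideanSpace.proj (𝕜 := ℝ) i) x :=
      (EuclideanSpace.proj (𝕜 := ℝ) i).hasFDerivAt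
    have hcoord : HasFDerivAt (fun y => V y i) (fderiv ℝ (fun y => V y i) x) x :=
      DifferentiableAt.hasFDerivAt (by fun_prop)
    rw [(hcoord.fun_sub (hproj.const_mul κ)).fderiv]
    simp
  simp [Matrix.trace, jacMatrix, entry, Finset.sum_sub_distrib]

/-- A maximum principle: if the field `Z` has positive divergence where `v > c`, and `v` does not
decrease along `Z`, then `v` cannot exceed `c` in a ball when it stays below `c` on the sphere. -/
lemma le_of_lt_on_sphere {n : ℕ} {v : Euc n → ℝ} {Z : Euc n → Euc n} {R c : ℝ}
    (hv : ContDiff ℝ 1 v) (hZ : ContDiff ℝ 1 Z) (hsphere : ∀ x, ‖x‖ = R → v x < c)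
    (hdiv : ∀ x, ‖x‖ < R → c < v x → 0 < (jacMatrix Z x).trace)
    (hmono : ∀ x, ‖x‖ < R → 0 ≤ fderiv ℝ v x (Z x)) {y : Euc n} (hy : ‖y‖ < R) : v y ≤ c := by
  by_contra! hcy
  set φ : Euc n → ℝ := fun x => Real.smoothTransition (v x - c) with hφ
  set h : Euc n → ℝ := fun x => if ‖x‖ < R then φ x else 0 with hh
  have h_inside {x : Euc n} (hx : ‖x‖ < R) : h =ᶠ[𝓝 x] φ := by
    filter_upwards [(isOpen_lt continuous_norm continuous_const).mem_nhds hx] with z hz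
    exact if_pos hz
  have h_outside {x : Euc n} (hx : R ≤ ‖x‖) : h =ᶠ[𝓝 x] fun _ => 0 := by
    rcases hx.eq_or_lt with hx | hx
    · filter_upwards [(isOpen_lt hv.continuous continuous_const).mem_nhds (hsphere x hx.symm)]
        with z hz
      have : φ z = 0 := Real.smoothTransition.zero_of_nonpos (sub_nonpos.2 (le_of_lt hz))
      simp [hh, this]
    · filter_upwards [(isOpen_lt continuous_const continuous_norm).mem_nhds hx] with z hz
      exact if_neg (not_lt.2 (le_of_lt hz))
  have φ_contDiff : ContDiff ℝ 1 φ :=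
    (Real.smoothTransition.contDiff (n := 1)).comp (hv.sub contDiff_const)
  have h_contDiff : ContDiff ℝ 1 h := by
    refine contDiff_iff_contDiffAt.2 fun x => ?_
    rcases lt_or_ge ‖x‖ R with hx | hx
    · exact φ_contDiff.contDiffAt.congr_of_eventuallyEq (h_inside hx)
    · exact contDiffAt_const.congr_of_eventuallyEq (h_outside hx)
  have Y_contDiff : ContDiff ℝ 1 fun x => h x • Z x := h_contDiff.smul hZ
  have Y_supp : HasCompactSupport fun x => h x • Z x := by
    refine HasCompactSupport.intro (isCompact_closedBall (0 : Euc n) R) fun x hx => ?_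
    have : ¬ ‖x‖ < R := fun hlt => hx (by simpa using hlt.le)
    simp [hh, this]
  have div_eq (x : Euc n) : (jacMatrix (fun z => h z • Z z) x).trace =
      h x * (jacMatrix Z x).trace + fderiv ℝ h x (Z x) :=
    trace_jacMatrix_smul (h_contDiff.differentiable one_ne_zero x)
      (hZ.differentiable one_ne_zero x)
  have fderiv_h_nonneg (x : Euc n) : 0 ≤ fderiv ℝ h x (Z x) := by
    rcases lt_or_ge ‖x‖ R with hx | hx
    · have transition_diff : DifferentiableAt ℝ Real.smoothTransition (v x - c) :=
        (Real.smoothTransition.contDiff (n := 1)).differentiable (by simp) _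
      have chain := transition_diff.hasDerivAt.comp_hasFDerivAt x
        ((hv.differentiable one_ne_zero x).hasFDerivAt.sub_const c)
      rw [(h_inside hx).fderiv_eq, show φ = Real.smoothTransition ∘ fun z => v z - c from rfl,
        chain.fderiv]
      exact mul_nonneg Real.smoothTransition.monotone.deriv_nonneg (hmono x hx)
    · simp [(h_outside hx).fderiv_eq]
  have h_mul_nonneg (x : Euc n) : 0 ≤ h x * (jacMatrix Z x).trace := by
    by_cases hx : ‖x‖ < R ∧ c < v x
    · have : 0 ≤ h x := by simp [hh, hx.1, hφ, Real.smoothTransition.nonneg]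
      exact mul_nonneg this (hdiv x hx.1 hx.2).le
    · have : h x = 0 := by
        by_cases hxR : ‖x‖ < R
        · have : v x ≤ c := not_lt.1 fun hc => hx ⟨hxR, hc⟩
          simp [hh, hxR, hφ, Real.smoothTransition.zero_of_nonpos (sub_nonpos.2 this)]
        · simp [hh, hxR]
      simp [this]
  have div_cont : Continuous fun x => (jacMatrix (fun z => h z • Z z) x).trace := by
    refine continuous_finsetSum _ fun i _ => ?_
    have : ContDiff ℝ 1 fun x => (h x • Z x) i := by fun_prop
    exact (this.continuous_fderiv one_ne_zero).clm_apply continuous_const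
  have div_supp : HasCompactSupport fun x => (jacMatrix (fun z => h z • Z z) x).trace := by
    refine HasCompactSupport.intro (isCompact_closedBall (0 : Euc n) R) fun x hx => ?_
    have hx : R < ‖x‖ := not_le.1 fun hle => hx (by simpa using hle)
    rw [div_eq, (h_outside hx.le).fderiv_eq, (h_outside hx.le).eq_of_nhds]
    simp
  have div_pos : (jacMatrix (fun z => h z • Z z) y).trace ≠ 0 := by
    have h_pos : 0 < h y := by
      simpa [hh, hy, hφ] using Real.smoothTransition.pos_of_pos (sub_pos.2 hcy)
    rw [div_eq]
    exact (add_pos_of_pos_of_nonneg (mul_pos h_pos (hdiv y hy hcy)) (fderiv_h_nonneg y)).ne'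
  have integral_pos := div_cont.integral_pos_of_hasCompactSupport_nonneg_nonzero (μ := volume)
    div_supp
    (fun x => (add_nonneg (h_mul_nonneg x) (fderiv_h_nonneg x)).trans_eq (div_eq x).symm) div_pos
  exact integral_pos.ne' (integral_divergence_eq_zero Y_contDiff Y_supp)

/-- A radial potential whose flux is `x ↦ κ x` and whose slope reaches `P` on the boundary sphere. -/
lemma Cond103.exists_radial_barrier {A : ℝ → ℝ} (hA : Cond103 A) {P κ : ℝ} (hP : 0 < P)
    (hκ : 0 < κ) (n : ℕ) :
    ∃ w : Euc n → ℝ, ContDiff ℝ 1 w ∧ w 0 = 0 ∧ (∀ x, 0 ≤ w x) ∧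
      (∀ x, ‖x‖ ≤ P * A P / κ → A ‖gradient w x‖ • gradient w x = κ • x) ∧
      ∀ x, ‖x‖ = P * A P / κ → fderiv ℝ w x x = P * ‖x‖ := by
  obtain ⟨G, G_cont, G_mono, G_zero, G_P, G_inv⟩ := hA.exists_inverse hP
  set D : ℝ → ℝ := fun r => G (κ * r) with hD
  have D_cont : Continuous D := by fun_prop
  have D_zero : D 0 = 0 := by simp [hD, G_zero]
  have D_nonneg {r : ℝ} (hr : 0 ≤ r) : 0 ≤ D r := by
    simpa [hD, G_zero] using G_mono.monotone (mul_nonneg hκ.le hr)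
  have profile_deriv (r : ℝ) : HasDerivAt (fun r => ∫ s in (0 : ℝ)..r, D s) (D r) r :=
    intervalIntegral.integral_hasDerivAt_right (D_cont.intervalIntegrable _ _)
      (D_cont.stronglyMeasurableAtFilter _ _) D_cont.continuousAt
  have w_deriv (x : Euc n) := hasFDerivAt_radial profile_deriv D_zero x
  have w_grad (x : Euc n) : gradient (fun y : Euc n => ∫ s in (0 : ℝ)..‖y‖, D s) x =
      (D ‖x‖ / ‖x‖) • x := HasGradientAt.gradient (w_deriv x)
  refine ⟨fun x => ∫ s in (0 : ℝ)..‖x‖, D s, ?_, by simp, fun x => ?_, fun x hx => ?_,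
    fun x hx => ?_⟩
  · exact contDiff_one_iff_hasFDerivAt.2
      ⟨_, (innerSL ℝ).continuous.comp (continuous_radial_field D_cont D_zero), w_deriv⟩
  · exact intervalIntegral.integral_nonneg (norm_nonneg x) fun s hs => D_nonneg hs.1
  · rw [w_grad]
    rcases eq_or_ne x 0 with rfl | hx0
    · simp
    have norm_pos : 0 < ‖x‖ := norm_pos_iff.2 hx0
    have norm_grad : ‖(D ‖x‖ / ‖x‖) • x‖ = D ‖x‖ := by
      rw [norm_smul, Real.norm_of_nonneg (div_nonneg (D_nonneg norm_pos.le) norm_pos.le),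
        div_mul_cancel₀ _ norm_pos.ne']
    have flux := G_inv (κ * ‖x‖) ⟨by positivity, by rwa [le_div_iff₀' hκ] at hx⟩
    rw [norm_grad, smul_smul]
    congr 1
    rw [mul_div_assoc', mul_comm (A _), flux, mul_div_cancel_right₀ _ norm_pos.ne']
  · have D_eq : D ‖x‖ = P := by
      rw [hD, hx]
      simp only
      rw [mul_div_cancel₀ _ hκ.ne', G_P]
    rw [(w_deriv x).fderiv]
    rcases eq_or_ne x 0 with rfl | hx0
    · simp
    have := norm_ne_zero_iff.2 hx0
    simp [D_eq]
    field_simp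

/-- At a maximum over a closed ball attained on the sphere, the radial derivative is nonnegative. -/
lemma fderiv_self_nonneg_of_isMaxOn_closedBall {E : Type*} [NormedAddCommGroup E]
    [NormedSpace ℝ E] {v : E → ℝ} {R : ℝ} {y : E} (hv : DifferentiableAt ℝ v y)
    (hmax : IsMaxOn v (Metric.closedBall 0 R) y) (hy : ‖y‖ ≤ R) : 0 ≤ fderiv ℝ v y y := by
  have hR : 0 ≤ R := (norm_nonneg y).trans hy
  have segment_subset : segment ℝ y (y + -y) ⊆ Metric.closedBall 0 R :=
    (convex_closedBall 0 R).segment_subset (by simpa using hy) (by simpa using hR)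
  simpa using hmax.localize.hasFDerivWithinAt_nonpos hv.hasFDerivAt.hasFDerivWithinAt
    (mem_posTangentConeAt_of_segment_subset segment_subset)

/-- Theorem 1.1: if lim_{p→∞} pA(p) < ∞, inequality (101) has no positive entire solution. -/
theorem no_positive_solution_finite_limit
    (n k : ℕ) (hk : 1 ≤ k) (hkn : k ≤ n) (A f : ℝ → ℝ)
    (hA : Cond103 A)
    (hfin : ∃ L : ℝ, Tendsto (fun p => p * A p) atTop (𝓝 L))
    (hf : Cond109 f) :
    ¬ ∃ u : Euc n → ℝ, (∀ x, 0 < u x) ∧ IsEntireSol n k A f u := by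
  rintro ⟨u, u_pos, u_contDiff, -, V, V_contDiff, V_eq, hsym, hcone, hineq⟩
  obtain ⟨L, hL⟩ := hfin
  set C : ℝ := (n.choose k : ℝ) ^ ((1 : ℝ) / k)
  have C_pos : 0 < C := Real.rpow_pos_of_pos (by exact_mod_cast Nat.choose_pos hkn) _
  have n_pos : (0 : ℝ) < n := by exact_mod_cast hk.trans hkn
  have trace_ge (x : Euc n) : f (u x) ≤ C * (jacMatrix V x).trace :=
    le_trace_of_le_sigmaElem_rpow hk (hsym x) (hcone x) (hineq x)
  set m : ℝ := u 0 / 2 with hm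
  have m_pos : 0 < m := half_pos (u_pos 0)
  have fm_pos : 0 < f m := hf.2.1 m m_pos
  set κ : ℝ := f m / (2 * C * n) with hκ
  have κ_pos : 0 < κ := by positivity
  obtain ⟨B, hB⟩ := (isCompact_closedBall (0 : Euc n) (L / κ)).exists_bound_of_continuousOn
    (u_contDiff.continuous_fderiv one_ne_zero).continuousOn
  set P : ℝ := max B 0 + 1
  have P_pos : 0 < P := by positivity
  have B_lt_P : B < P := (le_max_left B 0).trans_lt (lt_add_one _)
  set R : ℝ := P * A P / κ
  have R_pos : 0 < R := div_pos (mul_pos P_pos (hA.2.1 P P_pos)) κ_pos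
  have R_le : R ≤ L / κ := div_le_div_of_nonneg_right (hA.mul_le_of_tendsto hL P_pos.le) κ_pos.le
  obtain ⟨w, w_contDiff, w_zero, w_nonneg, w_flux, w_slope⟩ :=
    hA.exists_radial_barrier P_pos κ_pos n
  set v : Euc n → ℝ := fun x => u x - w x with hv
  have v_contDiff : ContDiff ℝ 1 v := u_contDiff.sub w_contDiff
  have fderiv_v (x : Euc n) : fderiv ℝ v x = fderiv ℝ u x - fderiv ℝ w x :=
    fderiv_fun_sub (u_contDiff.differentiable one_ne_zero x)
      (w_contDiff.differentiable one_ne_zero x)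
  obtain ⟨y, y_mem, y_max⟩ := (isCompact_closedBall (0 : Euc n) R).exists_isMaxOn
    ⟨0, by simpa using R_pos.le⟩ v_contDiff.continuous.continuousOn
  have lt_on_sphere (x : Euc n) (hx : ‖x‖ = R) : v x < v y := by
    have hx_mem : x ∈ Metric.closedBall (0 : Euc n) R := by simp [hx]
    refine (y_max hx_mem).lt_of_ne fun hxy => ?_
    have x_max : IsMaxOn v (Metric.closedBall 0 R) x := fun z hz => (y_max hz).trans_eq hxy.symm
    have radial := fderiv_self_nonneg_of_isMaxOn_closedBall
      (v_contDiff.differentiable one_ne_zero x) x_max hx.le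
    have bound : fderiv ℝ u x x ≤ B * R := by
      have := (fderiv ℝ u x).le_of_opNorm_le
        (hB x (Metric.closedBall_subset_closedBall R_le hx_mem)) x
      rw [hx] at this
      exact (le_abs_self _).trans this
    rw [fderiv_v, sub_apply, w_slope x hx, hx] at radial
    nlinarith
  obtain ⟨c, m_le_c, c_lt, sphere_lt⟩ :
      ∃ c, m ≤ c ∧ c < v y ∧ ∀ x, ‖x‖ = R → v x < c := by
    have m_lt : m < v y := by
      have : v 0 ≤ v y := y_max (by simpa using R_pos.le)
      simp only [hv, w_zero] at this ⊢
      linarith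
    rcases (Metric.sphere (0 : Euc n) R).eq_empty_or_nonempty with hempty | hnonempty
    · refine ⟨m, le_rfl, m_lt, fun x hx => ?_⟩
      exact absurd (mem_sphere_zero_iff_norm.2 hx) (hempty ▸ notMem_empty x)
    · obtain ⟨z, hz, z_max⟩ := (isCompact_sphere (0 : Euc n) R).exists_isMaxOn hnonempty
        v_contDiff.continuous.continuousOn
      obtain ⟨c, hc, c_lt⟩ := exists_between
        (max_lt m_lt (lt_on_sphere z (mem_sphere_zero_iff_norm.1 hz)))
      refine ⟨c, (le_max_left _ _).trans hc.le, c_lt, fun x hx => ?_⟩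
      exact (z_max (mem_sphere_zero_iff_norm.2 hx)).trans_lt ((le_max_right _ _).trans_lt hc)
  have y_norm : ‖y‖ < R := by
    refine lt_of_le_of_ne (by simpa using y_mem) fun h => ?_
    exact (lt_on_sphere y h).false
  refine c_lt.not_ge (le_of_lt_on_sphere v_contDiff
    (Z := fun x => V x - κ • x) (by fun_prop) sphere_lt
    (fun x hx hcx => ?_) (fun x hx => ?_) y_norm)
  · rw [trace_jacMatrix_sub_smul_id (V_contDiff.differentiable one_ne_zero x), sub_pos]
    have m_le_u : m ≤ u x := by
      have := w_nonneg x
      simp only [hv] at hcx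
      linarith
    have f_mono : f m ≤ f (u x) := hf.2.2 m_pos (u_pos x) m_le_u
    refine lt_of_mul_lt_mul_left (a := C) ?_ C_pos.le
    have : C * (n * κ) = f m / 2 := by
      rw [hκ]
      field_simp
    linarith [trace_ge x]
  · have := hA.inner_smul_sub_smul_nonneg (gradient u x) (gradient w x)
    rw [← V_eq, w_flux x hx.le, inner_sub_right, inner_gradient_right, inner_gradient_right] at this
    simpa [fderiv_v] using this
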